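/- arXiv:1806.01149 — 3 statements merged into one kernel-verified Lean document; each statement's English description precedes it below -/
import Mathlib

section
/- Let Φ_o(n) = ∑_{m ≤ n, m odd} φ(m) denote the sum of Euler's totient function over the odd positive integers not exceeding n. Then Φ_o(n) = 2·(n/π)² + O(n·log n) as n → ∞. -/
open Filter Finset Real

/-- The Möbius function restricted to the odd integers. -/
def oddMoebius : ArithmeticFunction ℝ :=
  ⟨fun d => if Odd d then (ArithmeticFunction.moebius d : ℝ) else 0, by simp⟩

/-- The identity function restricted to the odd integers. -/
def oddId : ArithmeticFunction ℝ :=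
  ⟨fun d => if Odd d then (d : ℝ) else 0, by simp⟩

lemma oddMoebius_apply (d : ℕ) :
    oddMoebius d = if Odd d then (ArithmeticFunction.moebius d : ℝ) else 0 := rfl

lemma oddId_apply (d : ℕ) : oddId d = if Odd d then (d : ℝ) else 0 := rfl

lemma abs_oddMoebius_le_one (d : ℕ) : |oddMoebius d| ≤ 1 := by
  rw [oddMoebius_apply]
  split_ifs
  · exact_mod_cast ArithmeticFunction.abs_moebius_le_one
  · simp

lemma oddMoebius_mul_oddId_apply {m : ℕ} (hm : 0 < m) :
    (oddMoebius * oddId) m = if Odd m then (Nat.totient m : ℝ) else 0 := by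
  rw [ArithmeticFunction.mul_apply]
  split_ifs with h
  · have key := (ArithmeticFunction.sum_eq_iff_sum_mul_moebius_eq
      (f := fun k => (Nat.totient k : ℝ)) (g := fun k => (k : ℝ))).1
      (fun n _ => by exact_mod_cast Nat.sum_totient n) m hm
    rw [← key]
    refine Finset.sum_congr rfl fun x hx => ?_
    rw [Nat.mem_divisorsAntidiagonal] at hx
    rw [← hx.1, Nat.odd_mul] at h
    rw [oddMoebius_apply, oddId_apply, if_pos h.1, if_pos h.2]
  · refine Finset.sum_eq_zero fun x hx => ?_
    rw [Nat.mem_divisorsAntidiagonal] at hx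
    rw [← hx.1, Nat.odd_mul, not_and_or] at h
    rw [oddMoebius_apply, oddId_apply]
    rcases h with h | h <;> simp [h]

lemma sum_oddId (q : ℕ) : ∑ k ∈ Ioc 0 q, oddId k = (((q + 1) / 2 : ℕ) : ℝ) ^ 2 := by
  induction q with
  | zero => simp
  | succ q ih =>
    rw [← Finset.insert_Ioc_right_eq_Ioc_add_one (Nat.zero_le q), Finset.sum_insert (by simp), ih,
      oddId_apply]
    rcases Nat.even_or_odd' q with ⟨c, rfl | rfl⟩
    · rw [if_pos ⟨c, rfl⟩, show (2 * c + 1) / 2 = c by omega,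
        show (2 * c + 1 + 1) / 2 = c + 1 by omega]
      push_cast
      ring
    · rw [if_neg (by rw [Nat.not_odd_iff_even]; exact ⟨c + 1, by ring⟩),
        show (2 * c + 1 + 1) / 2 = c + 1 by omega,
        show (2 * c + 1 + 1 + 1) / 2 = c + 1 by omega, zero_add]

lemma sum_oddId_div_sub_le {n d : ℕ} (hd : 0 < d) (hdn : d ≤ n) :
    |∑ k ∈ Ioc 0 (n / d), oddId k - (n / d : ℝ) ^ 2 / 4| ≤ (n / d : ℝ) := by
  rw [sum_oddId]
  have hd' : (0 : ℝ) < d := by exact_mod_cast hd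
  have hy : (1 : ℝ) ≤ n / d := by
    rw [le_div_iff₀ hd', one_mul]
    exact_mod_cast hdn
  have h1 : ((n / d : ℕ) : ℝ) ≤ n / d := Nat.cast_div_le
  have h2 : (n / d : ℝ) ≤ (n / d : ℕ) + 1 := by
    rw [div_le_iff₀ hd']
    exact_mod_cast (Nat.lt_mul_of_div_lt (Nat.lt_succ_self (n / d)) hd).le
  have h3 : ((n / d : ℕ) : ℝ) ≤ 2 * ((n / d + 1) / 2 : ℕ) := by
    exact_mod_cast (by omega : n / d ≤ 2 * ((n / d + 1) / 2))
  have h4 : 2 * (((n / d + 1) / 2 : ℕ) : ℝ) ≤ (n / d : ℕ) + 1 := by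
    exact_mod_cast (by omega : 2 * ((n / d + 1) / 2) ≤ n / d + 1)
  generalize (((n / d + 1) / 2 : ℕ) : ℝ) = s at *
  generalize (n / d : ℝ) = y at *
  rw [abs_le]
  constructor <;> nlinarith

lemma hasSum_oddMoebius_div_sq : HasSum (fun d : ℕ => oddMoebius d / (d : ℝ) ^ 2) (8 / π ^ 2) := by
  have h1 : 1 < (2 : ℂ).re := by norm_num
  set χ : DirichletCharacter ℂ 2 := 1 with hχ
  have hmul := DirichletCharacter.LSeries.mul_mu_eq_one χ h1
  have hL : LSeries (fun n => χ n) 2 = (π : ℂ) ^ 2 / 8 := by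
    rw [← DirichletCharacter.LFunction_eq_LSeries χ h1]
    have := DirichletCharacter.LFunctionTrivChar_eq_mul_riemannZeta (N := 2) (s := 2) (by norm_num)
    rw [DirichletCharacter.LFunctionTrivChar] at this
    rw [this, Nat.Prime.primeFactors Nat.prime_two, Finset.prod_singleton, riemannZeta_two,
      Complex.cpow_neg]
    norm_num
    ring
  have hs := (DirichletCharacter.LSeriesSummable_mul χ
    (ArithmeticFunction.LSeriesSummable_moebius_iff.mpr h1)).LSeriesHasSum
  have hv : LSeries ((fun n : ℕ => χ n) * fun n => (ArithmeticFunction.moebius n : ℂ)) 2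
      = ((8 / π ^ 2 : ℝ) : ℂ) := by
    rw [hL] at hmul
    have hπ : (π : ℂ) ≠ 0 := by exact_mod_cast Real.pi_ne_zero
    push_cast
    field_simp
    linear_combination 8 * hmul
  rw [hv, LSeriesHasSum] at hs
  rw [← Complex.hasSum_ofReal]
  convert hs using 2 with d
  rcases eq_or_ne d 0 with rfl | hd
  · simp
  rw [LSeries.term_of_ne_zero hd, oddMoebius_apply, Pi.mul_apply, hχ]
  by_cases h : Odd d
  · rw [MulChar.one_apply ((ZMod.isUnit_iff_coprime d 2).2 h.coprime_two_right), if_pos h]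
    push_cast
    rw [one_mul]
    norm_num
  · rw [MulChar.map_nonunit _ (by
      rwa [ZMod.isUnit_iff_coprime, Nat.coprime_two_right]), if_neg h]
    simp

lemma abs_sum_oddMoebius_div_sq_sub_le {n : ℕ} (hn : 0 < n) :
    |∑ d ∈ Ioc 0 n, oddMoebius d / (d : ℝ) ^ 2 - 8 / π ^ 2| ≤ 1 / (n : ℝ) := by
  have ht := hasSum_oddMoebius_div_sq.tendsto_sum_nat
  have ht' := ((tendsto_const_nhds (x := ∑ d ∈ Ioc 0 n, oddMoebius d / (d : ℝ) ^ 2)).sub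
    (ht.comp (tendsto_add_atTop_nat 1))).abs
  refine le_of_tendsto ht' ?_
  filter_upwards [eventually_ge_atTop n] with N hN
  have hsplit : ∑ d ∈ range (N + 1), oddMoebius d / (d : ℝ) ^ 2
      = ∑ d ∈ Ioc 0 n, oddMoebius d / (d : ℝ) ^ 2 + ∑ d ∈ Ioc n N, oddMoebius d / (d : ℝ) ^ 2 := by
    rw [Finset.sum_Ioc_consecutive _ (Nat.zero_le n) hN, Finset.sum_range_succ',
      Finset.range_eq_Ico, Finset.sum_Ico_add' (fun d : ℕ => oddMoebius d / (d : ℝ) ^ 2)]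
    simp
    rfl
  rw [Function.comp_apply, hsplit, sub_add_cancel_left, abs_neg]
  calc _ ≤ ∑ d ∈ Ioc n N, |oddMoebius d / (d : ℝ) ^ 2| := Finset.abs_sum_le_sum_abs _ _
    _ ≤ ∑ d ∈ Ioc n N, ((d : ℝ) ^ 2)⁻¹ := by
      refine Finset.sum_le_sum fun d _ => ?_
      rw [abs_div, abs_of_nonneg (sq_nonneg (d : ℝ)), ← one_div]
      gcongr
      exact abs_oddMoebius_le_one d
    _ ≤ (n : ℝ)⁻¹ - (N : ℝ)⁻¹ := sum_Ioc_inv_sq_le_sub hn.ne' hN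
    _ ≤ 1 / n := by
      rw [one_div]
      exact sub_le_self _ (by positivity)

lemma sum_totient_odd_eq (n : ℕ) :
    ∑ m ∈ (Finset.Icc 1 n).filter (fun m => Odd m), (Nat.totient m : ℝ)
      = ∑ d ∈ Ioc 0 n, oddMoebius d * ∑ k ∈ Ioc 0 (n / d), oddId k := by
  rw [← ArithmeticFunction.sum_Ioc_mul_eq_sum_sum, Finset.sum_filter]
  exact Finset.sum_congr rfl fun m hm => (oddMoebius_mul_oddId_apply (Finset.mem_Icc.1 hm).1).symm

lemma abs_sum_totient_odd_sub_le {n : ℕ} (hn : 0 < n) :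
    |∑ m ∈ (Finset.Icc 1 n).filter (fun m => Odd m), (Nat.totient m : ℝ) - 2 * ((n : ℝ) / π) ^ 2|
      ≤ n * (1 + Real.log n) + n / 4 := by
  rw [sum_totient_odd_eq]
  have hn' : (0 : ℝ) < n := by exact_mod_cast hn
  have hsplit : ∑ d ∈ Ioc 0 n, oddMoebius d * ∑ k ∈ Ioc 0 (n / d), oddId k - 2 * ((n : ℝ) / π) ^ 2
      = ∑ d ∈ Ioc 0 n, oddMoebius d * (∑ k ∈ Ioc 0 (n / d), oddId k - (n / d : ℝ) ^ 2 / 4)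
        + (n : ℝ) ^ 2 / 4 * (∑ d ∈ Ioc 0 n, oddMoebius d / (d : ℝ) ^ 2 - 8 / π ^ 2) := by
    rw [mul_sub, Finset.mul_sum, ← add_sub_assoc, ← Finset.sum_add_distrib]
    congr 1
    · exact Finset.sum_congr rfl fun d _ => by ring
    · ring
  rw [hsplit]
  refine (abs_add_le _ _).trans (add_le_add ?_ ?_)
  · calc _ ≤ ∑ d ∈ Ioc 0 n,
          |oddMoebius d * (∑ k ∈ Ioc 0 (n / d), oddId k - (n / d : ℝ) ^ 2 / 4)| :=
        Finset.abs_sum_le_sum_abs _ _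
      _ ≤ ∑ d ∈ Ioc 0 n, (n : ℝ) * (d : ℝ)⁻¹ := by
        refine Finset.sum_le_sum fun d hd => ?_
        rw [Finset.mem_Ioc] at hd
        rw [abs_mul, ← div_eq_mul_inv]
        exact (mul_le_of_le_one_left (abs_nonneg _) (abs_oddMoebius_le_one d)).trans
          (sum_oddId_div_sub_le hd.1 hd.2)
      _ = n * (harmonic n : ℝ) := by
        rw [← Finset.mul_sum, harmonic_eq_sum_Icc]
        push_cast
        rfl
      _ ≤ n * (1 + Real.log n) := by
        gcongr
        exact harmonic_le_one_add_log n
  · rw [abs_mul, abs_of_nonneg (by positivity)]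
    calc _ ≤ (n : ℝ) ^ 2 / 4 * (1 / n) := by
          gcongr
          exact abs_sum_oddMoebius_div_sq_sub_le hn
      _ = n / 4 := by field_simp

theorem phi_odd_sum_asymptotic :
    ∃ C : ℝ, 0 < C ∧ ∃ N : ℕ, ∀ n : ℕ, N ≤ n →
      |(∑ m ∈ (Finset.Icc 1 n).filter (fun m => Odd m), (Nat.totient m : ℝ)) -
          2 * ((n : ℝ) / π) ^ 2|
        ≤ C * n * Real.log n := by
  refine ⟨3, by norm_num, 3, fun n hn => (abs_sum_totient_odd_sub_le (by omega)).trans ?_⟩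
  have hn' : (3 : ℝ) ≤ n := by exact_mod_cast hn
  have hlog : 1 ≤ Real.log n := by
    rw [Real.le_log_iff_exp_le (by linarith)]
    linarith [Real.exp_one_lt_d9]
  nlinarith
end

section
/- Let Φ_e(n) = ∑_{m ≤ n, m even} φ(m) and Φ_o(n) = ∑_{m ≤ n, m odd} φ(m) denote the sums of Euler's totient function over the even and odd positive integers not exceeding n, respectively, and let Φ(n) = ∑_{m=1}^n φ(m). Then for every positive integer n, Φ_e(n) = Φ_o(⌊n/2⌋) + 2·Φ_e(⌊n/2⌋) = Φ(⌊n/2⌋) + Φ_e(⌊n/2⌋). -/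
open Finset

/-- Summing over the even numbers up to `n` is summing over the doubles of the numbers up to
`n / 2`. -/
theorem sum_filter_even_Icc {M : Type*} [AddCommMonoid M] (f : ℕ → M) (n : ℕ) :
    ∑ m ∈ (Finset.Icc 1 n).filter (fun m => Even m), f m
      = ∑ k ∈ Finset.Icc 1 (n / 2), f (2 * k) := by
  symm
  refine Finset.sum_bij (fun k _ => 2 * k) ?_ ?_ ?_ (fun _ _ => rfl)
  · intro k hk
    simp only [Finset.mem_filter, Finset.mem_Icc] at hk ⊢
    exact ⟨by omega, even_two_mul k⟩
  · intro a _ b _ h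
    omega
  · intro m hm
    simp only [Finset.mem_filter, Finset.mem_Icc] at hm
    obtain ⟨k, rfl⟩ := hm.2.two_dvd
    exact ⟨k, Finset.mem_Icc.2 (by omega), rfl⟩

theorem sum_filter_odd_add_sum_filter_even {M : Type*} [AddCommMonoid M] (s : Finset ℕ)
    (f : ℕ → M) :
    ∑ m ∈ s.filter (fun m => Odd m), f m + ∑ m ∈ s.filter (fun m => Even m), f m
      = ∑ m ∈ s, f m := by
  simpa only [Nat.not_odd_iff_even] using Finset.sum_filter_add_sum_filter_not s (fun m => Odd m) f

theorem sum_totient_two_mul (s : Finset ℕ) :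
    ∑ m ∈ s, Nat.totient (2 * m)
      = ∑ m ∈ s.filter (fun m => Odd m), Nat.totient m
        + 2 * ∑ m ∈ s.filter (fun m => Even m), Nat.totient m := by
  rw [← sum_filter_odd_add_sum_filter_even, Finset.mul_sum]
  congr 1
  · exact Finset.sum_congr rfl fun m hm =>
      Nat.totient_two_mul_of_odd (Finset.mem_filter.1 hm).2
  · exact Finset.sum_congr rfl fun m hm =>
      Nat.totient_two_mul_of_even (Finset.mem_filter.1 hm).2

theorem phi_even_sum_recursion (n : ℕ) (hn : 0 < n) :
    (∑ m ∈ (Finset.Icc 1 n).filter (fun m => Even m), Nat.totient m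
      = (∑ m ∈ (Finset.Icc 1 (n / 2)).filter (fun m => Odd m), Nat.totient m)
        + 2 * ∑ m ∈ (Finset.Icc 1 (n / 2)).filter (fun m => Even m), Nat.totient m)
    ∧ (∑ m ∈ (Finset.Icc 1 n).filter (fun m => Even m), Nat.totient m
      = (∑ m ∈ Finset.Icc 1 (n / 2), Nat.totient m)
        + ∑ m ∈ (Finset.Icc 1 (n / 2)).filter (fun m => Even m), Nat.totient m) := by
  rw [sum_filter_even_Icc, sum_totient_two_mul]
  refine ⟨rfl, ?_⟩
  rw [← sum_filter_odd_add_sum_filter_even (Finset.Icc 1 (n / 2)), two_mul, add_assoc]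
end

section
/- The limit as n → ∞ of (∑_{k=1}^n φ(3·(2k−1))) / (6n)² equals twice the limit as n → ∞ of (∑_{k=1}^n φ(3·(2k))) / (6n)²; that is, the sum of φ over odd multiples of 3 up to 6n is asymptotically twice the sum of φ over even multiples of 3 up to 6n, when both are normalized by (6n)². -/
open Filter Finset Real

open ArithmeticFunction in
theorem totient_eq_sum_divisors_moebius_mul_div {n : ℕ} (hn : 0 < n) :
    (n.totient : ℝ) = ∑ d ∈ n.divisors, (moebius d : ℝ) * (n / d) := by
  have key := (sum_eq_iff_sum_mul_moebius_eq (R := ℝ) (f := fun m => (m.totient : ℝ))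
    (g := fun m => (m : ℝ))).1 (fun m _ => by exact_mod_cast Nat.sum_totient m) n hn
  rw [← key, ← Nat.sum_divisorsAntidiagonal
    (fun d _ => (moebius d : ℝ) * ((n : ℝ) / (d : ℝ)))]
  refine Finset.sum_congr rfl fun x hx => ?_
  obtain ⟨hx, -⟩ := Nat.mem_divisorsAntidiagonal.1 hx
  have h1 : (x.1 : ℝ) ≠ 0 := by
    rintro h
    have : x.1 = 0 := by exact_mod_cast h
    simp [this] at hx
    omega
  rw [← hx]
  push_cast
  field_simp

theorem sum_Icc_multiples (q n : ℕ) :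
    (∑ k ∈ Finset.Icc 1 n, if q ∣ k then (k : ℝ) else 0) =
      q * ((n / q : ℕ) * ((n / q : ℕ) + 1)) / 2 := by
  induction n with
  | zero => simp
  | succ n ih =>
    rw [Finset.sum_Icc_succ_top (by omega), ih, Nat.succ_div]
    split_ifs with h
    · have h2 : n + 1 = q * (n / q + 1) := by
        have := Nat.succ_div (a := n) (b := q)
        rw [if_pos h] at this
        rw [← this, Nat.mul_div_cancel' h]
      have h3 : ((n + 1 : ℕ) : ℝ) = q * ((n / q : ℕ) + 1) := by exact_mod_cast h2
      rw [h3]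
      push_cast
      ring
    · simp

theorem tendsto_sum_Icc_multiples_div_sq {q : ℕ} (hq : 0 < q) :
    Tendsto (fun n : ℕ => (∑ k ∈ Finset.Icc 1 n, if q ∣ k then (k : ℝ) else 0) / (n : ℝ) ^ 2)
      atTop (nhds (1 / (2 * q))) := by
  have hq' : (q : ℝ) ≠ 0 := by positivity
  have h1 : Tendsto (fun n : ℕ => ((n / q : ℕ) : ℝ) / n) atTop (nhds (1 / q)) := by
    have := (tendsto_nat_floor_mul_div_atTop (R := ℝ) (a := 1 / q) (by positivity)).comp
      tendsto_natCast_atTop_atTop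
    refine this.congr fun n => ?_
    simp only [Function.comp]
    rw [← Nat.floor_div_eq_div (K := ℝ) n q]
    congr 3
    ring
  have h2 : Tendsto (fun n : ℕ => 1 / (n : ℝ)) atTop (nhds 0) := tendsto_one_div_atTop_nhds_zero_nat
  have h3 := ((h1.mul (h1.add h2)).const_mul (q : ℝ)).div_const 2
  have e : (q : ℝ) * (1 / q * (1 / q + 0)) / 2 = 1 / (2 * q) := by field_simp; simp
  rw [e] at h3
  refine h3.congr fun n => ?_
  rw [sum_Icc_multiples]
  rcases Nat.eq_zero_or_pos n with rfl | hn
  · simp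
  · field_simp

theorem sum_Icc_multiples_div_sq_le {q : ℕ} (hq : 0 < q) (n : ℕ) :
    (∑ k ∈ Finset.Icc 1 n, if q ∣ k then (k : ℝ) else 0) / (n : ℝ) ^ 2 ≤ 1 / q := by
  rw [sum_Icc_multiples]
  rcases Nat.eq_zero_or_pos n with rfl | hn
  · simp
  have hq' : (0 : ℝ) < q := by positivity
  have h1 : (q : ℝ) * (n / q : ℕ) ≤ n := by exact_mod_cast Nat.mul_div_le n q
  have h2 : ((n / q : ℕ) : ℝ) ≤ ((n / q : ℕ) : ℝ) ^ 2 := by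
    exact_mod_cast Nat.le_self_pow (by norm_num) _
  have h3 : ((q : ℝ) * (n / q : ℕ)) ^ 2 ≤ (n : ℝ) ^ 2 := by gcongr
  rw [div_le_div_iff₀ (by positivity) hq']
  nlinarith [mul_le_mul_of_nonneg_left h2 (sq_nonneg (q : ℝ))]

theorem tendsto_sum_totient_mul_div_sq {a : ℕ} (ha : 0 < a) :
    ∃ L : ℝ, Tendsto (fun n : ℕ => (∑ k ∈ Finset.Icc 1 n, (Nat.totient (a * k) : ℝ)) / (n : ℝ) ^ 2)
      atTop (nhds L) := by
  let S : ℕ → ℕ → ℝ := fun d n =>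
    (∑ k ∈ Finset.Icc 1 n, if d / d.gcd a ∣ k then (k : ℝ) else 0) / (n : ℝ) ^ 2
  let c : ℕ → ℝ := fun d => (ArithmeticFunction.moebius d : ℝ) * (a / d)
  have hquot {d : ℕ} (hd : 0 < d) : 0 < d / d.gcd a :=
    Nat.div_pos (Nat.gcd_le_left a hd) (Nat.gcd_pos_of_pos_left a hd)
  have hsum (n : ℕ) : (∑ k ∈ Finset.Icc 1 n, (Nat.totient (a * k) : ℝ)) / (n : ℝ) ^ 2 =
      ∑' d, c d * S d n := by
    have hdvd (d k : ℕ) (hd : 0 < d) : d / d.gcd a ∣ k ↔ d ∣ a * k := by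
      have hg := Nat.gcd_pos_of_pos_left a hd
      have hc := Nat.coprime_div_gcd_div_gcd hg
      rw [← hc.dvd_mul_left (k := d / d.gcd a) (m := a / d.gcd a) (n := k)]
      conv_rhs => rw [← Nat.div_mul_cancel (Nat.gcd_dvd_left d a)]
      rw [← Nat.mul_dvd_mul_iff_right hg]
      have : a / d.gcd a * k * d.gcd a = a * k := by
        rw [mul_right_comm, Nat.div_mul_cancel (Nat.gcd_dvd_right d a)]
      rw [this]
    rw [tsum_eq_sum (s := Finset.Icc 1 (a * n))]
    · simp only [S, mul_div_assoc', Finset.mul_sum, ← Finset.sum_div]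
      congr 1
      rw [Finset.sum_comm]
      refine Finset.sum_congr rfl fun k hk => ?_
      obtain ⟨hk1, hkn⟩ := Finset.mem_Icc.1 hk
      rw [totient_eq_sum_divisors_moebius_mul_div (by positivity)]
      have hsub : (a * k).divisors ⊆ Finset.Icc 1 (a * n) := fun d hd =>
        Finset.mem_Icc.2 ⟨Nat.pos_of_mem_divisors hd,
          (Nat.divisor_le hd).trans (Nat.mul_le_mul_left a hkn)⟩
      rw [← Finset.sum_subset hsub]
      · refine Finset.sum_congr rfl fun d hd => ?_
        rw [if_pos ((hdvd d k (Nat.pos_of_mem_divisors hd)).2 (Nat.dvd_of_mem_divisors hd))]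
        simp only [c]
        push_cast
        ring
      · intro d hd hd'
        rw [if_neg, mul_zero]
        rw [hdvd d k (Finset.mem_Icc.1 hd).1]
        exact fun h => hd' (Nat.mem_divisors.2 ⟨h, by positivity⟩)
    · intro d hd
      rcases Nat.eq_zero_or_pos d with rfl | hd0
      · simp [c]
      · have : S d n = 0 := by
          simp only [S]
          rw [Finset.sum_eq_zero, zero_div]
          intro k hk
          obtain ⟨hk1, hkn⟩ := Finset.mem_Icc.1 hk
          rw [if_neg]
          rw [hdvd d k hd0]
          intro h
          exact hd (Finset.mem_Icc.2 ⟨hd0,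
            (Nat.le_of_dvd (by positivity) h).trans (Nat.mul_le_mul_left a hkn)⟩)
        rw [this, mul_zero]
  refine ⟨∑' d, c d * (1 / (2 * (d / d.gcd a : ℕ))), ?_⟩
  simp_rw [hsum]
  refine tendsto_tsum_of_dominated_convergence (bound := fun d : ℕ => (a : ℝ) ^ 2 * (1 / (d : ℝ) ^ 2))
    ((Real.summable_one_div_nat_pow.2 one_lt_two).mul_left _) ?_ (Eventually.of_forall ?_)
  · intro d
    rcases Nat.eq_zero_or_pos d with rfl | hd
    · simp [c]
    · exact (tendsto_sum_Icc_multiples_div_sq (hquot hd)).const_mul _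
  · intro n d
    rcases Nat.eq_zero_or_pos d with rfl | hd
    · simp [c]
    have hμ : |(ArithmeticFunction.moebius d : ℝ)| ≤ 1 := by
      exact_mod_cast ArithmeticFunction.abs_moebius_le_one (n := d)
    have hS0 : 0 ≤ S d n := by positivity
    have hS : S d n ≤ a / d := by
      refine (sum_Icc_multiples_div_sq_le (hquot hd) n).trans ?_
      have hq' := hquot hd
      rw [div_le_div_iff₀ (by positivity) (by positivity), one_mul]
      have : d ≤ a * (d / d.gcd a) := by
        conv_lhs => rw [← Nat.mul_div_cancel' (Nat.gcd_dvd_left d a)]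
        exact Nat.mul_le_mul_right _ (Nat.gcd_le_right d ha)
      exact_mod_cast this
    rw [Real.norm_eq_abs, abs_mul, abs_of_nonneg hS0]
    simp only [c]
    rw [abs_mul, abs_of_nonneg (by positivity : (0 : ℝ) ≤ a / d)]
    calc _ ≤ 1 * ((a : ℝ) / d) * (a / d) := by gcongr
      _ = _ := by ring

theorem sum_totient_odd_multiples_of_three (n : ℕ) :
    (∑ k ∈ Finset.Icc 1 n, (Nat.totient (3 * (2 * k - 1)) : ℝ)) =
      (∑ k ∈ Finset.Icc 1 (2 * n), (Nat.totient (6 * k) : ℝ)) -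
        2 * ∑ k ∈ Finset.Icc 1 n, (Nat.totient (6 * k) : ℝ) := by
  induction n with
  | zero => simp
  | succ n ih =>
    rw [Finset.sum_Icc_succ_top (by omega), ih, show 2 * (n + 1) = 2 * n + 1 + 1 by ring,
      Finset.sum_Icc_succ_top (by omega), Finset.sum_Icc_succ_top (by omega),
      Finset.sum_Icc_succ_top (by omega)]
    have h1 : Nat.totient (6 * (2 * n + 1 + 1)) = 2 * Nat.totient (6 * (n + 1)) := by
      rw [← Nat.totient_mul_of_prime_of_dvd Nat.prime_two (by omega)]
      congr 1
      ring
    have h2 : Nat.totient (6 * (2 * n + 1)) = Nat.totient (3 * (2 * n + 1)) := by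
      rw [show 6 * (2 * n + 1) = 2 * (3 * (2 * n + 1)) by ring,
        Nat.totient_mul_of_prime_of_not_dvd Nat.prime_two (by omega)]
      simp
    rw [h1, h2, show 2 * n + 1 + 1 - 1 = 2 * n + 1 by omega]
    push_cast
    ring

theorem phi_sum_odd_multiples_of_3_twice_even :
    ∃ L₁ L₂ : ℝ,
      Tendsto (fun n : ℕ =>
          (∑ k ∈ Finset.Icc 1 n, (Nat.totient (3 * (2 * k - 1)) : ℝ)) / (6 * (n : ℝ)) ^ 2)
        atTop (nhds L₁) ∧
      Tendsto (fun n : ℕ =>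
          (∑ k ∈ Finset.Icc 1 n, (Nat.totient (3 * (2 * k)) : ℝ)) / (6 * (n : ℝ)) ^ 2)
        atTop (nhds L₂) ∧
      L₁ = 2 * L₂ := by
  obtain ⟨L, hL⟩ := tendsto_sum_totient_mul_div_sq (a := 6) (by norm_num)
  have hL2 := hL.comp (tendsto_id.const_mul_atTop' (r := 2) (by norm_num : 0 < 2))
  refine ⟨(4 * L - 2 * L) / 36, L / 36, ?_, ?_, by ring⟩
  · refine (((hL2.const_mul 4).sub (hL.const_mul 2)).div_const 36).congr fun n => ?_
    rw [sum_totient_odd_multiples_of_three]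
    simp only [Function.comp, id]
    push_cast
    rcases Nat.eq_zero_or_pos n with rfl | hn
    · simp
    · field_simp
      ring
  · refine (hL.div_const 36).congr fun n => ?_
    simp only [← mul_assoc, div_div]
    congr 1
    ring
end
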